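/- arXiv:1807.11443 — 10 statements merged into one kernel-verified Lean document; each statement's English description precedes it below -/
import Mathlib

section
/- Let m, p, q, r, s be positive integers with q > p ≥ m and q > r + s, let α, β be nonzero complex numbers, and let τ ∈ ℂ \ {0, 1}. Define x(t) = α t^m (t − τ)^{−s} and y(t) = β t^p (t − 1)^{q−p} (t − τ)^{r−q} on ℂ \ {0, 1, τ}. If m = s, or ps = m(q − r), or qs = m(q − r), then there is no t ∈ ℂ \ {0, 1, τ} with x′(t) = 0 and y′(t) = 0. -/
/-- The derivative of a shifted integer power, in logarithmic form. -/
lemma hasDerivAt_sub_zpow {c t : ℂ} (n : ℤ) (h : t ≠ c) :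
    HasDerivAt (fun z : ℂ => (z - c) ^ n) ((t - c) ^ n * (n / (t - c))) t := by
  have h0 : t - c ≠ 0 := sub_ne_zero.mpr h
  have h1 := (hasDerivAt_zpow n (t - c) (Or.inl h0)).comp_sub_const t c
  have h2 : (n : ℂ) * (t - c) ^ (n - 1) = (t - c) ^ n * (n / (t - c)) := by
    rw [zpow_sub_one₀ h0]
    ring
  exact h2 ▸ h1

/-- The derivative of an integer power, in logarithmic form. -/
lemma hasDerivAt_zpow_logarithmic {t : ℂ} (n : ℤ) (h : t ≠ 0) :
    HasDerivAt (fun z : ℂ => z ^ n) (t ^ n * (n / t)) t := by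
  simpa using hasDerivAt_sub_zpow (c := 0) n h


/-- In the same setting as Statement 1, if `m = s`, or `p·s = m·(q - r)`,
or `q·s = m·(q - r)` (in ℤ), then there is no `t ∈ ℂ \ {0, 1, τ}` at which both
derivatives `x'(t)` and `y'(t)` vanish. -/
theorem stmt_2 (m p q r s : ℕ) (hm : 0 < m) (hp : 0 < p) (hq : 0 < q) (hr : 0 < r)
    (hs : 0 < s) (hqp : p < q) (hpm : m ≤ p) (hqrs : r + s < q)
    (α β τ : ℂ) (hα : α ≠ 0) (hβ : β ≠ 0) (hτ0 : τ ≠ 0) (hτ1 : τ ≠ 1)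
    (hdeg : m = s ∨ (p : ℤ) * s = m * ((q : ℤ) - r) ∨ (q : ℤ) * s = m * ((q : ℤ) - r)) :
    ¬ ∃ t : ℂ, t ≠ 0 ∧ t ≠ 1 ∧ t ≠ τ ∧
      deriv (fun z : ℂ => α * z ^ (m : ℤ) * (z - τ) ^ (-(s : ℤ))) t = 0 ∧
      deriv (fun z : ℂ =>
        β * z ^ (p : ℤ) * (z - 1) ^ ((q : ℤ) - (p : ℤ)) * (z - τ) ^ ((r : ℤ) - (q : ℤ))) t
        = 0 := by
  rintro ⟨t, ht0, ht1, htτ, hx, hy⟩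
  have h1 : t - 1 ≠ 0 := sub_ne_zero.mpr ht1
  have hτ : t - τ ≠ 0 := sub_ne_zero.mpr htτ
  have dx := ((hasDerivAt_zpow_logarithmic (m : ℤ) ht0).const_mul α).mul
    (hasDerivAt_sub_zpow (-(s : ℤ)) htτ)
  have dy := (((hasDerivAt_zpow_logarithmic (p : ℤ) ht0).const_mul β).mul
    (hasDerivAt_sub_zpow ((q : ℤ) - (p : ℤ)) ht1)).mul
    (hasDerivAt_sub_zpow ((r : ℤ) - (q : ℤ)) htτ)
  replace hx := dx.deriv.symm.trans hx
  replace hy := dy.deriv.symm.trans hy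
  have nx : α * t ^ (m : ℤ) * (t - τ) ^ (-(s : ℤ)) ≠ 0 :=
    mul_ne_zero (mul_ne_zero hα (zpow_ne_zero _ ht0)) (zpow_ne_zero _ hτ)
  have ny : β * t ^ (p : ℤ) * (t - 1) ^ ((q : ℤ) - (p : ℤ)) *
      (t - τ) ^ ((r : ℤ) - (q : ℤ)) ≠ 0 :=
    mul_ne_zero (mul_ne_zero (mul_ne_zero hβ (zpow_ne_zero _ ht0)) (zpow_ne_zero _ h1))
      (zpow_ne_zero _ hτ)
  have ex : (m : ℂ) / t - s / (t - τ) = 0 := by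
    refine (mul_eq_zero.mp (Eq.trans ?_ hx)).resolve_left nx
    push_cast
    ring
  have ey : (p : ℂ) / t + (q - p) / (t - 1) + (r - q) / (t - τ) = 0 := by
    refine (mul_eq_zero.mp (Eq.trans ?_ hy)).resolve_left ny
    simp only [Pi.mul_apply]
    push_cast
    ring
  have hmC : (m : ℂ) ≠ 0 := Nat.cast_ne_zero.mpr hm.ne'
  have hsC : (s : ℂ) ≠ 0 := Nat.cast_ne_zero.mpr hs.ne'
  have hqpC : (q : ℂ) - p ≠ 0 := sub_ne_zero.mpr (Nat.cast_injective.ne hqp.ne')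
  have ex' : (m : ℂ) * (t - τ) = s * t := by
    field_simp at ex
    linear_combination ex
  have key : ((p : ℂ) * s - m * (q - r)) * (t - 1) + (q - p) * s * t = 0 := by
    have hinv : 1 / (t - τ) = m / (s * t) := by
      rw [div_eq_div_iff hτ (mul_ne_zero hsC ht0)]
      linear_combination -ex'
    rw [div_eq_mul_one_div ((r : ℂ) - q), hinv] at ey
    field_simp at ey
    linear_combination ey
  rcases hdeg with h | h | h
  · subst h
    exact mul_ne_zero hmC hτ0 (by linear_combination -ex')
  · have h' : (p : ℂ) * s = m * (q - r) := by exact_mod_cast congrArg (Int.cast : ℤ → ℂ) h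
    exact mul_ne_zero (mul_ne_zero hqpC hsC) ht0 (by linear_combination key - (t - 1) * h')
  · have h' : (q : ℂ) * s = m * (q - r) := by exact_mod_cast congrArg (Int.cast : ℤ → ℂ) h
    exact mul_ne_zero hqpC hsC (by linear_combination key - (t - 1) * h')
end

section
/- Let m ≥ 4 be an integer, let f ∈ ℂ[X] be monic of degree m, let ε ∈ {1, −1}, let s ≥ 1 be an integer, and let A, B, C, D ∈ ℂ[X] be monic polynomials with A(0) ≠ 0, with B·D squarefree of degree 3, and with f − ε = X^{2s+1} · A² · B and f + ε = C² · D. Then s = 1, and both A and C are squarefree. -/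
open Polynomial

theorem Polynomial.dvd_derivative_of_mul_self_dvd {R : Type*} [CommRing R] {x p : R[X]}
    (h : x * x ∣ p) : x ∣ derivative p := by
  obtain ⟨c, rfl⟩ := h
  refine ⟨derivative x * c + derivative x * c + x * derivative c, ?_⟩
  simp only [derivative_mul]
  ring

/-- If `f` is monic of degree `m ≥ 4`, `ε ∈ {1,-1}`, `s ≥ 1`, and
`f - ε = X^{2s+1} A² B`, `f + ε = T² D` with `A, B, T, D` monic, `A(0) ≠ 0`, and
`B·D` squarefree of degree 3, then `s = 1` and both `A` and `T` are squarefree.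
(Here `T` plays the role of the polynomial called `C` in the natural-language
statement, renamed to avoid clashing with `Polynomial.C`.) -/
theorem stmt_6 (m : ℕ) (hm : 4 ≤ m) (f : ℂ[X]) (hf : f.Monic) (hfdeg : f.natDegree = m)
    (ε : ℂ) (hε : ε = 1 ∨ ε = -1) (s : ℕ) (hs : 1 ≤ s)
    (A B T D : ℂ[X]) (hAm : A.Monic) (hBm : B.Monic) (hTm : T.Monic) (hDm : D.Monic)
    (hA0 : A.eval 0 ≠ 0)
    (hBDsf : Squarefree (B * D)) (hBDdeg : (B * D).natDegree = 3)
    (h1 : f - C ε = X ^ (2 * s + 1) * A ^ 2 * B)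
    (h2 : f + C ε = T ^ 2 * D) :
    s = 1 ∧ Squarefree A ∧ Squarefree T := by
  have hε0 : ε ≠ 0 := by rcases hε with rfl | rfl <;> norm_num
  have hcop : IsCoprime (X ^ (2 * s) * A) T := by
    refine ⟨-(C (2 * ε)⁻¹ * (X * A * B)), C (2 * ε)⁻¹ * (T * D), ?_⟩
    have hC : C (2 * ε)⁻¹ * (C ε + C ε) = (1 : ℂ[X]) := by
      rw [← C_add, ← C_mul, ← two_mul, inv_mul_cancel₀ (by simpa using hε0), C_1]
    linear_combination C (2 * ε)⁻¹ * h1 - C (2 * ε)⁻¹ * h2 + hC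
  have hd1 : derivative f = X ^ (2 * s) * A *
      (C (2 * s + 1 : ℂ) * A * B + C 2 * X * derivative A * B + X * A * derivative B) := by
    have h := congrArg derivative h1
    simp only [derivative_sub, derivative_C, sub_zero, derivative_mul,
      derivative_pow] at h
    rw [h]
    simp
    ring
  have hd2 : derivative f = T * (C 2 * derivative T * D + T * derivative D) := by
    have h := congrArg derivative h2
    simp only [derivative_add, derivative_C, add_zero, derivative_mul, derivative_pow] at h
    rw [h]
    simp
    ring
  obtain ⟨R, hR⟩ := hcop.mul_dvd (Dvd.intro _ hd1.symm) (Dvd.intro _ hd2.symm)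
  have hXA : (X ^ (2 * s) * A).Monic := (monic_X_pow _).mul hAm
  have hfd : (derivative f).natDegree = m - 1 := by
    rw [natDegree_derivative, hfdeg]
  have hR0 : R ≠ 0 := by
    rintro rfl
    rw [hR, mul_zero, natDegree_zero] at hfd
    omega
  have hdegR : 2 * s + A.natDegree + T.natDegree + R.natDegree = m - 1 := by
    rw [← hfd, hR, (hXA.mul hTm).natDegree_mul' hR0, hXA.natDegree_mul hTm,
      (monic_X_pow _).natDegree_mul hAm, natDegree_X_pow]
  have hdeg1 : m = 2 * s + 1 + 2 * A.natDegree + B.natDegree := by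
    have h := congrArg natDegree h1
    rwa [natDegree_sub_C, hfdeg, ((monic_X_pow _).mul (hAm.pow 2)).natDegree_mul hBm,
      (monic_X_pow _).natDegree_mul (hAm.pow 2), natDegree_X_pow, hAm.natDegree_pow] at h
  have hdeg2 : m = 2 * T.natDegree + D.natDegree := by
    have h := congrArg natDegree h2
    rwa [natDegree_add_C, hfdeg, (hTm.pow 2).natDegree_mul hDm, hTm.natDegree_pow] at h
  rw [hBm.natDegree_mul hDm] at hBDdeg
  have hRunit : IsUnit R := by
    rw [isUnit_iff_degree_eq_zero, degree_eq_natDegree hR0]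
    exact_mod_cast (by omega : R.natDegree = 0)
  refine ⟨by omega, fun x hx => ?_, fun x hx => ?_⟩
  · have hxA : x ∣ A := (Dvd.intro _ rfl).trans hx
    have hxA' := dvd_derivative_of_mul_self_dvd hx
    have hTR : T * R =
        C (2 * s + 1 : ℂ) * A * B + C 2 * X * derivative A * B + X * A * derivative B := by
      apply mul_left_cancel₀ hXA.ne_zero
      rw [← hd1, hR, ← mul_assoc]
    have hxT : x ∣ T := by
      rw [← hRunit.dvd_mul_right, hTR]
      exact dvd_add (dvd_add ((hxA.mul_left _).mul_right _) ((hxA'.mul_left _).mul_right _))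
        ((hxA.mul_left _).mul_right _)
    exact hcop.isUnit_of_dvd' (hxA.mul_left _) hxT
  · have hxT : x ∣ T := (Dvd.intro _ rfl).trans hx
    have hxT' := dvd_derivative_of_mul_self_dvd hx
    have hAR : X ^ (2 * s) * A * R = C 2 * derivative T * D + T * derivative D := by
      apply mul_left_cancel₀ hTm.ne_zero
      rw [← hd2, hR]
      ring
    have hxA : x ∣ X ^ (2 * s) * A := by
      rw [← hRunit.dvd_mul_right, hAR]
      exact dvd_add ((hxT'.mul_left _).mul_right _) (hxT.mul_right _)
    exact hcop.isUnit_of_dvd' hxA hxT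
end

section
/- Let m ≥ 4 be an integer, let f ∈ ℂ[X] be monic of degree m, let ε ∈ {1, −1}, and let A, B, C, D ∈ ℂ[X] be monic polynomials with A(0) ≠ 0, B·D squarefree of degree 3, f − ε = X³ · A² · B and f + ε = C² · D. Then 3·A·B + 2X·A′·B + X·A·B′ = m·C and 2·C′·D + C·D′ = m·X²·A. -/
open Polynomial

/-- A factorization of `f'` as `M * K` with `f` monic of degree `n + 1` and `M` monic of
degree `n` forces `K` to be the constant `n + 1`. -/
theorem Polynomial.eq_C_of_derivative_eq_monic_mul {R : Type*} [CommRing R] {f M K : R[X]}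
    {n : ℕ} (hf : f.Monic) (hfdeg : f.natDegree = n + 1) (hM : M.Monic)
    (hMdeg : M.natDegree = n) (h : derivative f = M * K) : K = C ((n + 1 : ℕ) : R) := by
  have hle : (derivative f).natDegree ≤ n := by
    have := natDegree_derivative_le f
    omega
  have hcoeff : (derivative f).coeff n = ((n + 1 : ℕ) : R) := by
    rw [coeff_derivative, ← hfdeg, hf.coeff_natDegree, hfdeg]
    push_cast
    ring
  have hK : K.natDegree = 0 := by
    rcases eq_or_ne K 0 with rfl | hK0
    · simp
    · rw [h, hM.natDegree_mul' hK0] at hle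
      omega
  obtain ⟨k, rfl⟩ := natDegree_eq_zero.mp hK
  rw [h, coeff_mul_C, ← hMdeg, hM.coeff_natDegree, one_mul, hMdeg] at hcoeff
  rw [hcoeff]

/-- If `f` is monic of degree `m ≥ 4`, `ε ∈ {1,-1}`,
`f - ε = X³ A² B` and `f + ε = T² D` with `A, B, T, D` monic, `A(0) ≠ 0`, and `B·D`
squarefree of degree 3, then `3·A·B + 2X·A'·B + X·A·B' = m·T` and
`2·T'·D + T·D' = m·X²·A`. (Here `T` plays the role of the polynomial called `C` in
the natural-language statement, renamed to avoid clashing with `Polynomial.C`.) -/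
theorem stmt_7 (m : ℕ) (hm : 4 ≤ m) (f : ℂ[X]) (hf : f.Monic) (hfdeg : f.natDegree = m)
    (ε : ℂ) (hε : ε = 1 ∨ ε = -1)
    (A B T D : ℂ[X]) (hAm : A.Monic) (hBm : B.Monic) (hTm : T.Monic) (hDm : D.Monic)
    (hA0 : A.eval 0 ≠ 0)
    (hBDsf : Squarefree (B * D)) (hBDdeg : (B * D).natDegree = 3)
    (h1 : f - C ε = X ^ 3 * A ^ 2 * B)
    (h2 : f + C ε = T ^ 2 * D) :
    3 * A * B + 2 * X * (derivative A) * B + X * A * (derivative B) = C (m : ℂ) * T ∧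
    2 * (derivative T) * D + T * (derivative D) = C (m : ℂ) * X ^ 2 * A := by
  have hε0 : ε ≠ 0 := by rcases hε with rfl | rfl <;> norm_num
  obtain ⟨n, rfl⟩ : ∃ n, m = n + 1 := ⟨m - 1, by omega⟩
  have d1 : derivative f = X ^ 2 * A *
      (3 * A * B + 2 * X * (derivative A) * B + X * A * (derivative B)) := by
    have := congrArg derivative h1
    simp only [derivative_sub, derivative_C, sub_zero, derivative_mul,
      derivative_pow, map_natCast] at this
    rw [this]
    norm_num
    ring
  have d2 : derivative f = T * (2 * (derivative T) * D + T * (derivative D)) := by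
    have := congrArg derivative h2
    simp only [derivative_add, derivative_C, add_zero, derivative_mul,
      derivative_pow, map_natCast] at this
    rw [this]
    norm_num
    ring
  have hcop : IsCoprime T (X ^ 2 * A) := by
    have hunit : C (2 * ε)⁻¹ * C (2 * ε) = (1 : ℂ[X]) := by
      rw [← C_mul, inv_mul_cancel₀ (by simpa using hε0), C_1]
    refine ⟨C (2 * ε)⁻¹ * (T * D), -(C (2 * ε)⁻¹ * (X * A * B)), ?_⟩
    rw [← hunit, two_mul ε, C_add]
    linear_combination C (ε + ε)⁻¹ * (h1 - h2)
  obtain ⟨K, hK⟩ := hcop.dvd_of_dvd_mul_left (d1 ▸ d2 ▸ dvd_mul_right T _)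
  have e1 : 3 + 2 * A.natDegree + B.natDegree = n + 1 := by
    rw [← hfdeg, ← natDegree_sub_C (p := f) (a := ε), h1,
      ((monic_X_pow 3).mul (hAm.pow 2)).natDegree_mul hBm,
      (monic_X_pow 3).natDegree_mul (hAm.pow 2), natDegree_X_pow, hAm.natDegree_pow]
  have e2 : 2 * T.natDegree + D.natDegree = n + 1 := by
    rw [← hfdeg, ← natDegree_add_C (p := f) (a := ε), h2, (hTm.pow 2).natDegree_mul hDm,
      hTm.natDegree_pow]
  rw [hBm.natDegree_mul hDm] at hBDdeg
  have hXA : (X ^ 2 * A).Monic := (monic_X_pow 2).mul hAm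
  have hMdeg : (X ^ 2 * A * T).natDegree = n := by
    rw [hXA.natDegree_mul hTm, (monic_X_pow 2).natDegree_mul hAm, natDegree_X_pow]
    omega
  have hKC := eq_C_of_derivative_eq_monic_mul (K := K) hf hfdeg (hXA.mul hTm) hMdeg
    (by rw [d1, hK]; ring)
  subst hKC
  refine ⟨by rw [hK]; ring, mul_left_cancel₀ hTm.ne_zero ?_⟩
  rw [← d2, d1, hK]
  ring
end

section
/- Let m ≥ 4 be an integer, let f ∈ ℂ[X] be monic of degree m, let ξ ∈ ℂ, let s ≥ 1 be an integer, and let Q, R ∈ ℂ[X] be monic polynomials with Q(ξ) ≠ 0, R(ξ) ≠ 0, R squarefree of degree 3, gcd(Q, R) = 1, and f² − 1 = (X − ξ)^{2s+1} · Q² · R. Then s = 1, Q has degree m − 3 and is squarefree, and Q is coprime to (X − ξ)·R; consequently f² − 1 has exactly one root of multiplicity 3 (namely ξ), exactly m − 3 roots of multiplicity 2 (the roots of Q), and exactly 3 simple roots (the roots of R). -/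
open Polynomial

/-- A separable polynomial over an algebraically closed field has as many roots as its degree. -/
theorem ncard_isRoot_eq_natDegree {K : Type*} [Field K] [IsAlgClosed K] {P : K[X]}
    (hP : P.Separable) : {x : K | P.IsRoot x}.ncard = P.natDegree := by
  classical
  have hset : {x : K | P.IsRoot x} = (P.roots.toFinset : Set K) := by
    ext x
    simp [hP.ne_zero]
  rw [hset, Set.ncard_coe_finset, Multiset.toFinset_card_of_nodup (nodup_roots hP)]
  exact (IsAlgClosed.splits P).natDegree_eq_card_roots.symm

/-- If `f² - 1 = (X - ξ)^{k+1} Q² R`, then `(X - ξ)^k Q` divides the derivative of `f`, and twice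
the quotient times `f` is the remaining factor of the derivative of `f² - 1`. -/
theorem exists_derivative_eq_mul {K : Type*} [Field K] [NeZero (2 : K)] {f Q R : K[X]} {ξ : K}
    {k : ℕ} (hQ : Q ≠ 0) (hfact : f ^ 2 - 1 = (X - C ξ) ^ (k + 1) * Q ^ 2 * R) :
    ∃ c : K[X], derivative f = (X - C ξ) ^ k * Q * c ∧
      2 * c * f = ((k + 1 : ℕ) : K[X]) * Q * R +
        (X - C ξ) * (2 * derivative Q * R + Q * derivative R) := by
  have hD : (X - C ξ) ^ k * Q ≠ 0 := mul_ne_zero (pow_ne_zero _ (X_sub_C_ne_zero ξ)) hQ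
  have hder : 2 * f * derivative f = (X - C ξ) ^ k * Q * (((k + 1 : ℕ) : K[X]) * Q * R +
      (X - C ξ) * (2 * derivative Q * R + Q * derivative R)) := by
    have h := congrArg derivative hfact
    simp only [derivative_sub, derivative_one, derivative_mul, derivative_X, derivative_C,
      derivative_pow, Nat.add_sub_cancel, map_natCast] at h
    push_cast at h ⊢
    linear_combination h
  have h2 : (C (2⁻¹ : K)) * 2 = 1 := by
    rw [← C_ofNat, ← C_mul, inv_mul_cancel₀ two_ne_zero, C_1]
  have hcop : IsCoprime ((X - C ξ) ^ k * Q) (2 * f) :=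
    ⟨-((X - C ξ) * Q * R), C 2⁻¹ * f, by linear_combination hfact + f ^ 2 * h2⟩
  obtain ⟨c, hc⟩ := hcop.dvd_of_dvd_mul_left ⟨_, hder⟩
  refine ⟨c, hc, mul_left_cancel₀ hD ?_⟩
  rw [← hder, hc]
  ring

/-- If `f` is monic of degree `m ≥ 4` and
`f² - 1 = (X - ξ)^{2s+1} Q² R` with `Q, R` monic, `Q(ξ) ≠ 0`, `R(ξ) ≠ 0`, `R`
squarefree of degree 3, and `Q, R` coprime, then `s = 1`, `Q` is squarefree of degree
`m - 3` and coprime to `(X - ξ)·R`; consequently `f² - 1` has exactly one root of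
multiplicity 3 (namely `ξ`), exactly `m - 3` roots of multiplicity 2 (the roots of `Q`),
and exactly 3 simple roots (the roots of `R`). -/
theorem stmt_8 (m : ℕ) (hm : 4 ≤ m) (f : ℂ[X]) (hf : f.Monic) (hfdeg : f.natDegree = m)
    (ξ : ℂ) (s : ℕ) (hs : 1 ≤ s)
    (Q R : ℂ[X]) (hQm : Q.Monic) (hRm : R.Monic)
    (hQξ : Q.eval ξ ≠ 0) (hRξ : R.eval ξ ≠ 0)
    (hRsf : Squarefree R) (hRdeg : R.natDegree = 3) (hcop : IsCoprime Q R)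
    (hfact : f ^ 2 - 1 = (X - C ξ) ^ (2 * s + 1) * Q ^ 2 * R) :
    s = 1 ∧ Q.natDegree = m - 3 ∧ Squarefree Q ∧ IsCoprime Q ((X - C ξ) * R) ∧
    {x : ℂ | rootMultiplicity x (f ^ 2 - 1) = 3} = {ξ} ∧
    {x : ℂ | rootMultiplicity x (f ^ 2 - 1) = 2} = {x : ℂ | Q.IsRoot x} ∧
    {x : ℂ | Q.IsRoot x}.ncard = m - 3 ∧
    {x : ℂ | rootMultiplicity x (f ^ 2 - 1) = 1} = {x : ℂ | R.IsRoot x} ∧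
    {x : ℂ | R.IsRoot x}.ncard = 3 := by
  have hfact0 : f ^ 2 - 1 ≠ 0 := by
    intro h
    have h1 : f ^ 2 = 1 := sub_eq_zero.1 h
    have h2 := congrArg natDegree h1
    rw [natDegree_pow, natDegree_one, hfdeg] at h2
    omega
  have hdeg : 2 * m = 2 * s + 1 + 2 * Q.natDegree + 3 := by
    have h := congrArg natDegree hfact
    rwa [(((monic_X_sub_C ξ).pow _).mul (hQm.pow 2)).natDegree_mul hRm,
      ((monic_X_sub_C ξ).pow _).natDegree_mul (hQm.pow 2), natDegree_pow, natDegree_pow,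
      natDegree_X_sub_C, hRdeg, ← C_1, natDegree_sub_C, natDegree_pow, hfdeg, mul_one] at h
  obtain ⟨c, hc, hcf⟩ := exists_derivative_eq_mul hQm.ne_zero hfact
  have hf'deg : (derivative f).natDegree = m - 1 := by
    rw [natDegree_derivative, hfdeg]
  have hc0 : c ≠ 0 := by
    rintro rfl
    rw [hc, mul_zero, natDegree_zero] at hf'deg
    omega
  have hdeg' : m - 1 = 2 * s + Q.natDegree + c.natDegree := by
    rw [← hf'deg, hc, (((monic_X_sub_C ξ).pow _).mul hQm).natDegree_mul' hc0,
      ((monic_X_sub_C ξ).pow _).natDegree_mul hQm, natDegree_pow, natDegree_X_sub_C, mul_one]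
  obtain rfl : s = 1 := by omega
  obtain ⟨a, rfl⟩ := natDegree_eq_zero.1 (show c.natDegree = 0 by omega)
  have hQdeg : Q.natDegree = m - 3 := by omega
  have ha : a ≠ 0 := by simpa using hc0
  have hQsep : Q.Separable := by
    refine (isCoprime_iff_aeval_ne_zero_of_isAlgClosed ℂ ℂ _ _).2 fun x ↦ ?_
    by_contra! h
    simp only [coe_aeval_eq_eval] at h
    have h1 := congrArg (eval x) hcf
    have h2 := congrArg (eval x) hfact
    simp [h.1, h.2, ha] at h1 h2
    simp [h1] at h2
  have hRsep : R.Separable := PerfectField.separable_iff_squarefree.2 hRsf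
  have hQX : IsCoprime Q (X - C ξ) := by
    refine ((irreducible_X_sub_C ξ).coprime_iff_not_dvd.2 ?_).symm
    rwa [dvd_iff_isRoot]
  have hmult (x : ℂ) : rootMultiplicity x (f ^ 2 - 1) =
      3 * (if x = ξ then 1 else 0) + 2 * rootMultiplicity x Q + rootMultiplicity x R := by
    have h0 := hfact ▸ hfact0
    rw [hfact, rootMultiplicity_mul h0, rootMultiplicity_mul (left_ne_zero_of_mul h0),
      ← count_roots, ← count_roots, roots_pow, roots_pow, Multiset.count_nsmul,
      Multiset.count_nsmul, count_roots, count_roots, rootMultiplicity_X_sub_C]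
  have hQ1 := rootMultiplicity_le_one_of_separable hQsep
  have hR1 := rootMultiplicity_le_one_of_separable hRsep
  have hQpos (x : ℂ) := rootMultiplicity_pos hQm.ne_zero (x := x)
  have hRpos (x : ℂ) := rootMultiplicity_pos hRm.ne_zero (x := x)
  have hQR (x : ℂ) : ¬ (Q.IsRoot x ∧ R.IsRoot x) := by
    rintro ⟨h1, h2⟩
    obtain ⟨u, v, h⟩ := hcop
    simpa [h1.eq_zero, h2.eq_zero] using congrArg (eval x) h
  have hξ (x : ℂ) (hx : x = ξ) : ¬ Q.IsRoot x ∧ ¬ R.IsRoot x := hx ▸ ⟨hQξ, hRξ⟩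
  refine ⟨rfl, hQdeg, hQsep.squarefree, hQX.mul_right hcop, ?_, ?_,
    (ncard_isRoot_eq_natDegree hQsep).trans hQdeg, ?_,
    (ncard_isRoot_eq_natDegree hRsep).trans hRdeg⟩
  all_goals
    ext x
    have h1 := hQ1 x
    have h2 := hR1 x
    have h3 := hQR x
    have h4 := hξ x
    simp only [Set.mem_ofPred_eq, Set.mem_singleton_iff, hmult x]
    rw [← hQpos x, ← hRpos x] at h3 h4
    try rw [← hQpos x]
    try rw [← hRpos x]
    split_ifs with hx <;> simp only [hx, true_imp_iff] at h4 ⊢ <;> grind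
end

section
/- Let n ≥ 1 be an integer and let ξ₁, ξ₂, ξ₃ be nonzero complex numbers with ξ₁ ≠ (−1)^n · ξ₂. Then the set of triples (α, β, γ) with α, β nonzero complex numbers and γ ∈ ℂ \ {0, 1} satisfying α·β^n·γ^n = ξ₁, α·β^n·(1 − γ)^n = ξ₂ and α = ξ₃·β^{2n} has exactly 3n² elements. -/
open Polynomial in
theorem Complex.card_nthRootsFinset_of_ne_zero {n : ℕ} (hn : n ≠ 0) {a : ℂ} (ha : a ≠ 0) :
    (nthRootsFinset n a).card = n := by
  classical
  have hζ := Complex.isPrimitiveRoot_exp n hn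
  rw [nthRootsFinset_def, Multiset.toFinset_card_of_nodup (hζ.nthRoots_nodup ha),
    hζ.card_nthRoots, if_pos]
  exact IsAlgClosed.exists_pow_nat_eq a (Nat.pos_of_ne_zero hn)

/-- For `n ≥ 1` and nonzero `ξ₁, ξ₂, ξ₃ ∈ ℂ` with `ξ₁ ≠ (-1)^n ξ₂`, the
set of triples `(α, β, γ)` with `α, β ∈ ℂ*`, `γ ∈ ℂ \ {0,1}`, satisfying
`α β^n γ^n = ξ₁`, `α β^n (1-γ)^n = ξ₂`, `α = ξ₃ β^{2n}` has exactly `3n²` elements. -/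
theorem stmt_10 (n : ℕ) (hn : 1 ≤ n) (ξ₁ ξ₂ ξ₃ : ℂ)
    (h1 : ξ₁ ≠ 0) (h2 : ξ₂ ≠ 0) (h3 : ξ₃ ≠ 0) (h12 : ξ₁ ≠ (-1) ^ n * ξ₂) :
    {t : ℂ × ℂ × ℂ | t.1 ≠ 0 ∧ t.2.1 ≠ 0 ∧ t.2.2 ≠ 0 ∧ t.2.2 ≠ 1 ∧
        t.1 * t.2.1 ^ n * t.2.2 ^ n = ξ₁ ∧
        t.1 * t.2.1 ^ n * (1 - t.2.2) ^ n = ξ₂ ∧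
        t.1 = ξ₃ * t.2.1 ^ (2 * n)}.Finite ∧
    {t : ℂ × ℂ × ℂ | t.1 ≠ 0 ∧ t.2.1 ≠ 0 ∧ t.2.2 ≠ 0 ∧ t.2.2 ≠ 1 ∧
        t.1 * t.2.1 ^ n * t.2.2 ^ n = ξ₁ ∧
        t.1 * t.2.1 ^ n * (1 - t.2.2) ^ n = ξ₂ ∧
        t.1 = ξ₃ * t.2.1 ^ (2 * n)}.ncard = 3 * n ^ 2 := by
  have hn0 : n ≠ 0 := by omega
  have h3n : 3 * n ≠ 0 := by omega
  let W : Finset ℂ := Polynomial.nthRootsFinset n (ξ₂ / ξ₁)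
  let B : ℂ → Finset ℂ := fun w => Polynomial.nthRootsFinset (3 * n) (ξ₁ * (1 + w) ^ n / ξ₃)
  let f : (Σ _ : ℂ, ℂ) → ℂ × ℂ × ℂ := fun p => (ξ₃ * p.2 ^ (2 * n), p.2, (1 + p.1)⁻¹)
  have memW {w : ℂ} : w ∈ W ↔ w ^ n = ξ₂ / ξ₁ :=
    Polynomial.mem_nthRootsFinset (Nat.pos_of_ne_zero hn0) _
  have memB {w b : ℂ} : b ∈ B w ↔ b ^ (3 * n) = ξ₁ * (1 + w) ^ n / ξ₃ :=
    Polynomial.mem_nthRootsFinset (Nat.pos_of_ne_zero h3n) _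
  have W_ne {w : ℂ} (hw : w ∈ W) : 1 + w ≠ 0 := by
    intro h
    rw [memW, eq_neg_of_add_eq_zero_right h, eq_div_iff h1] at hw
    refine h12 ?_
    rw [← hw, ← mul_assoc, ← mul_pow]
    simp
  have pow_ne {w : ℂ} (hw : w ∈ W) : ξ₁ * (1 + w) ^ n / ξ₃ ≠ 0 :=
    div_ne_zero (mul_ne_zero h1 (pow_ne_zero _ (W_ne hw))) h3
  have hf : Function.Injective f := by
    rintro ⟨w, b⟩ ⟨w', b'⟩ h
    simp only [f, Prod.mk.injEq, inv_inj, add_right_inj] at h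
    obtain ⟨-, rfl, rfl⟩ := h
    rfl
  have hcard : ((W.sigma B).image f).card = 3 * n ^ 2 := by
    rw [Finset.card_image_of_injective _ hf, Finset.card_sigma,
      Finset.sum_congr rfl fun w hw =>
        Complex.card_nthRootsFinset_of_ne_zero h3n (pow_ne hw),
      Finset.sum_const, Complex.card_nthRootsFinset_of_ne_zero hn0 (div_ne_zero h2 h1), smul_eq_mul]
    ring
  have split_pow (b : ℂ) : b ^ (3 * n) = b ^ (2 * n) * b ^ n := by rw [← pow_add]; congr 1; ring
  suffices hS : {t : ℂ × ℂ × ℂ | t.1 ≠ 0 ∧ t.2.1 ≠ 0 ∧ t.2.2 ≠ 0 ∧ t.2.2 ≠ 1 ∧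
        t.1 * t.2.1 ^ n * t.2.2 ^ n = ξ₁ ∧
        t.1 * t.2.1 ^ n * (1 - t.2.2) ^ n = ξ₂ ∧
        t.1 = ξ₃ * t.2.1 ^ (2 * n)} = ((W.sigma B).image f : Finset (ℂ × ℂ × ℂ)) by
    rw [hS, Set.ncard_coe_finset]
    exact ⟨Finset.finite_toSet _, hcard⟩
  ext ⟨a, b, c⟩
  simp only [Set.mem_ofPred_eq, Finset.coe_image, Set.mem_image, Finset.mem_coe, Finset.mem_sigma,
    Sigma.exists]
  constructor
  · rintro ⟨-, hb, hc, -, e1, e2, rfl⟩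
    refine ⟨(1 - c) / c, b, ⟨?_, ?_⟩, ?_⟩
    · rw [memW, div_pow, ← e1, ← e2]
      field_simp
    · have : 1 + (1 - c) / c = c⁻¹ := by field_simp; ring
      rw [memB, this, split_pow, ← e1, inv_pow]
      field_simp
    · have : 1 + (1 - c) / c = c⁻¹ := by field_simp; ring
      simp only [f, this, inv_inv]
  · rintro ⟨w, b', ⟨hw, hb⟩, h⟩
    simp only [f, Prod.mk.injEq] at h
    obtain ⟨rfl, rfl, rfl⟩ := h
    have hw1 := W_ne hw
    have hb0 : b' ≠ 0 := Polynomial.ne_zero_of_mem_nthRootsFinset (pow_ne hw) hb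
    have hw0 : w ≠ 0 := Polynomial.ne_zero_of_mem_nthRootsFinset (div_ne_zero h2 h1) hw
    rw [memW, eq_div_iff h1] at hw
    rw [memB, split_pow, eq_div_iff h3] at hb
    have e1 : ξ₃ * b' ^ (2 * n) * b' ^ n * (1 + w)⁻¹ ^ n = ξ₁ := by
      rw [inv_pow, mul_inv_eq_iff_eq_mul₀ (pow_ne_zero _ hw1), ← hb]
      ring
    refine ⟨mul_ne_zero h3 (pow_ne_zero _ hb0), hb0, inv_ne_zero hw1, ?_, e1, ?_, rfl⟩
    · simpa using hw0
    · have : 1 - (1 + w)⁻¹ = (1 + w)⁻¹ * w := by field_simp; ring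
      rw [this, mul_pow, ← mul_assoc, e1, mul_comm, hw]
end

section
/- Let n ≥ 1 be an integer and let ξ₁, ξ₂ be nonzero complex numbers. Then the set of triples (α, β, γ) with α, β nonzero complex numbers and γ ∈ ℂ \ {0, 1} satisfying α·β^n·γ^n = ξ₁, α·β^n·(1 − γ)^n = −ξ₁ and α = ξ₂·β^{2n} has exactly 3n² elements if n is even, and exactly 3n(n − 1) elements if n is odd. -/
theorem Complex.ncard_setOf_pow_eq {k : ℕ} (hk : 0 < k) {a : ℂ} (ha : a ≠ 0) :
    {z : ℂ | z ^ k = a}.ncard = k := by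
  obtain ⟨c, rfl⟩ := IsAlgClosed.exists_pow_nat_eq a hk
  have hc : c ≠ 0 := by
    rintro rfl
    exact ha (zero_pow hk.ne')
  have h : {z : ℂ | z ^ k = c ^ k} =
      (fun z ↦ c * z) '' (Polynomial.nthRootsFinset k (1 : ℂ) : Set ℂ) := by
    ext z
    simp only [Set.mem_ofPred_eq, Set.mem_image, Finset.mem_coe,
      Polynomial.mem_nthRootsFinset hk]
    constructor
    · intro hz
      exact ⟨z / c, by rw [div_pow, hz, div_self ha], by field_simp⟩
    · rintro ⟨y, hy, rfl⟩
      rw [mul_pow, hy, mul_one]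
  rw [h, Set.ncard_image_of_injective _ (mul_right_injective₀ hc), Set.ncard_coe_finset,
    (Complex.isPrimitiveRoot_exp k hk.ne').card_nthRootsFinset]

theorem Complex.one_sub_pow_eq_neg_pow_iff {n : ℕ} (γ : ℂ) :
    (γ ≠ 0 ∧ (1 - γ) ^ n = -γ ^ n) ↔ ∃ w : ℂ, (w ^ n = -1 ∧ w ≠ -1) ∧ (1 + w)⁻¹ = γ := by
  constructor
  · rintro ⟨h0, h⟩
    refine ⟨(1 - γ) / γ, ⟨?_, ?_⟩, ?_⟩
    · rw [div_pow, h, neg_div, div_self (pow_ne_zero n h0)]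
    · intro hw
      rw [div_eq_iff h0] at hw
      exact one_ne_zero (α := ℂ) (by linear_combination hw)
    · have : 1 + (1 - γ) / γ = γ⁻¹ := by field_simp; ring
      rw [this, inv_inv]
  · rintro ⟨w, ⟨hw, hne⟩, rfl⟩
    have h : 1 + w ≠ 0 := fun h ↦ hne (by linear_combination h)
    refine ⟨inv_ne_zero h, ?_⟩
    have : 1 - (1 + w)⁻¹ = w * (1 + w)⁻¹ := by field_simp; ring
    rw [this, mul_pow, hw]
    ring

theorem Complex.exists_injOn_image_eq (n : ℕ) (hn : 1 ≤ n) (ξ₁ ξ₂ : ℂ) (h1 : ξ₁ ≠ 0)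
    (h2 : ξ₂ ≠ 0) :
    ∃ f : ℂ × ℂ → ℂ × ℂ × ℂ,
      Set.InjOn f ({w : ℂ | w ^ n = -1 ∧ w ≠ -1} ×ˢ {z : ℂ | z ^ (3 * n) = 1}) ∧
      {t : ℂ × ℂ × ℂ | t.1 ≠ 0 ∧ t.2.1 ≠ 0 ∧ t.2.2 ≠ 0 ∧ t.2.2 ≠ 1 ∧
        t.1 * t.2.1 ^ n * t.2.2 ^ n = ξ₁ ∧
        t.1 * t.2.1 ^ n * (1 - t.2.2) ^ n = -ξ₁ ∧
        t.1 = ξ₂ * t.2.1 ^ (2 * n)} =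
      f '' ({w : ℂ | w ^ n = -1 ∧ w ≠ -1} ×ˢ {z : ℂ | z ^ (3 * n) = 1}) := by
  have hn0 : n ≠ 0 := by omega
  choose r hr using fun γ : ℂ ↦
    IsAlgClosed.exists_pow_nat_eq (ξ₁ / (ξ₂ * γ ^ n)) (show 0 < 3 * n by omega)
  have hr0 : ∀ γ : ℂ, γ ≠ 0 → r γ ≠ 0 := by
    intro γ hγ h
    have := hr γ
    rw [h, zero_pow (by omega)] at this
    exact div_ne_zero h1 (mul_ne_zero h2 (pow_ne_zero n hγ)) this.symm
  refine ⟨fun p ↦ (ξ₂ * (r (1 + p.1)⁻¹ * p.2) ^ (2 * n), r (1 + p.1)⁻¹ * p.2, (1 + p.1)⁻¹),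
    ?_, ?_⟩
  · rintro ⟨w, z⟩ ⟨⟨-, hw⟩, -⟩ ⟨w', z'⟩ - h
    simp only [Prod.mk.injEq] at h
    obtain ⟨-, hz, hww⟩ := h
    have hγ : (1 + w)⁻¹ ≠ 0 := inv_ne_zero fun h ↦ hw (by dsimp only; linear_combination h)
    obtain rfl : w = w' := add_left_cancel (inv_injective hww)
    rw [mul_right_inj' (hr0 _ hγ)] at hz
    rw [hz]
  · ext ⟨α, β, γ⟩
    simp only [Set.mem_ofPred_eq, Set.mem_image, Prod.exists, Set.mem_prod, Prod.mk.injEq]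
    constructor
    · rintro ⟨hα, hβ, hγ, -, e1, e2, e3⟩
      have hpow : (1 - γ) ^ n = -γ ^ n :=
        mul_left_cancel₀ (mul_ne_zero hα (pow_ne_zero n hβ)) (by linear_combination e1 + e2)
      obtain ⟨w, hw, rfl⟩ := (Complex.one_sub_pow_eq_neg_pow_iff γ).1 ⟨hγ, hpow⟩
      set γ := (1 + w)⁻¹
      have hrβ : r γ * (β / r γ) = β := mul_div_cancel₀ β (hr0 γ hγ)
      refine ⟨w, β / r γ, ⟨hw, ?_⟩, ?_, hrβ, rfl⟩
      · have hβ3 : β ^ (3 * n) = ξ₁ / (ξ₂ * γ ^ n) := by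
          rw [eq_div_iff (mul_ne_zero h2 (pow_ne_zero n hγ)), ← e1, e3]
          ring
        rw [div_pow, hr, hβ3, div_self (div_ne_zero h1 (mul_ne_zero h2 (pow_ne_zero n hγ)))]
      · rw [hrβ, e3]
    · rintro ⟨w, z, ⟨hw, hz⟩, rfl, rfl, rfl⟩
      obtain ⟨hγ, hpow⟩ := (Complex.one_sub_pow_eq_neg_pow_iff (1 + w)⁻¹).2 ⟨w, hw, rfl⟩
      set γ := (1 + w)⁻¹
      have hz0 : z ≠ 0 := by
        rintro rfl
        rw [zero_pow (by omega)] at hz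
        exact zero_ne_one hz
      have hβ : r γ * z ≠ 0 := mul_ne_zero (hr0 γ hγ) hz0
      have e1 : ξ₂ * (r γ * z) ^ (2 * n) * (r γ * z) ^ n * γ ^ n = ξ₁ := by
        have hβ3 : (r γ * z) ^ (3 * n) = ξ₁ / (ξ₂ * γ ^ n) := by
          rw [mul_pow, hz, hr, mul_one]
        rw [eq_div_iff (mul_ne_zero h2 (pow_ne_zero n hγ))] at hβ3
        rw [← hβ3]
        ring
      refine ⟨mul_ne_zero h2 (pow_ne_zero _ hβ), hβ, hγ, ?_, e1, ?_, rfl⟩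
      · intro h
        rw [h, sub_self, zero_pow hn0, one_pow] at hpow
        exact one_ne_zero (α := ℂ) (by linear_combination hpow)
      · rw [hpow]
        linear_combination -e1


/-- For `n ≥ 1` and nonzero `ξ₁, ξ₂ ∈ ℂ`, the set of triples `(α, β, γ)`
with `α, β ∈ ℂ*`, `γ ∈ ℂ \ {0,1}`, satisfying `α β^n γ^n = ξ₁`,
`α β^n (1-γ)^n = -ξ₁`, `α = ξ₂ β^{2n}` has exactly `3n²` elements if `n` is even and
exactly `3n(n-1)` elements if `n` is odd. -/
theorem stmt_11 (n : ℕ) (hn : 1 ≤ n) (ξ₁ ξ₂ : ℂ) (h1 : ξ₁ ≠ 0) (h2 : ξ₂ ≠ 0) :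
    {t : ℂ × ℂ × ℂ | t.1 ≠ 0 ∧ t.2.1 ≠ 0 ∧ t.2.2 ≠ 0 ∧ t.2.2 ≠ 1 ∧
        t.1 * t.2.1 ^ n * t.2.2 ^ n = ξ₁ ∧
        t.1 * t.2.1 ^ n * (1 - t.2.2) ^ n = -ξ₁ ∧
        t.1 = ξ₂ * t.2.1 ^ (2 * n)}.Finite ∧
    (Even n →
      {t : ℂ × ℂ × ℂ | t.1 ≠ 0 ∧ t.2.1 ≠ 0 ∧ t.2.2 ≠ 0 ∧ t.2.2 ≠ 1 ∧
        t.1 * t.2.1 ^ n * t.2.2 ^ n = ξ₁ ∧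
        t.1 * t.2.1 ^ n * (1 - t.2.2) ^ n = -ξ₁ ∧
        t.1 = ξ₂ * t.2.1 ^ (2 * n)}.ncard = 3 * n ^ 2) ∧
    (Odd n →
      {t : ℂ × ℂ × ℂ | t.1 ≠ 0 ∧ t.2.1 ≠ 0 ∧ t.2.2 ≠ 0 ∧ t.2.2 ≠ 1 ∧
        t.1 * t.2.1 ^ n * t.2.2 ^ n = ξ₁ ∧
        t.1 * t.2.1 ^ n * (1 - t.2.2) ^ n = -ξ₁ ∧
        t.1 = ξ₂ * t.2.1 ^ (2 * n)}.ncard = 3 * n * (n - 1)) := by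
  obtain ⟨f, hf, hS⟩ := Complex.exists_injOn_image_eq n hn ξ₁ ξ₂ h1 h2
  have hZ : {z : ℂ | z ^ (3 * n) = 1}.ncard = 3 * n :=
    Complex.ncard_setOf_pow_eq (by omega) one_ne_zero
  have hV : {w : ℂ | w ^ n = -1}.ncard = n :=
    Complex.ncard_setOf_pow_eq hn (neg_ne_zero.2 one_ne_zero)
  have hZfin : {z : ℂ | z ^ (3 * n) = 1}.Finite :=
    Set.finite_of_ncard_ne_zero (by omega)
  have hVfin : {w : ℂ | w ^ n = -1}.Finite := Set.finite_of_ncard_ne_zero (by omega)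
  have hW : {w : ℂ | w ^ n = -1 ∧ w ≠ -1} = {w : ℂ | w ^ n = -1} \ {-1} := rfl
  rw [hS, hf.ncard_image, Set.ncard_prod, hZ, hW]
  refine ⟨((hVfin.sdiff).prod hZfin).image f, fun he ↦ ?_, fun ho ↦ ?_⟩
  · rw [Set.sdiff_singleton_eq_self, hV]
    · ring
    · rw [Set.mem_ofPred_eq, he.neg_one_pow]
      norm_num
  · rw [Set.ncard_sdiff_singleton_of_mem (s := {w : ℂ | w ^ n = -1}) ho.neg_one_pow, hV,
      mul_comm]
end

section
/- Let n ≥ 1 be an integer, let α, β be nonzero complex numbers, and let S ∈ ℂ[t] be a monic cubic polynomial. Define x(t) = α·t^n·(t − 1)^n and y(t) = β·S(t)/(t(t − 1)) on ℂ \ {0, 1}. Then there exists t₀ ∈ ℂ \ {0, 1} with x′(t₀) = 0, y(t₀) = 0 and y′(t₀) = 0 if and only if there exists γ ∈ ℂ with S(t) = (t − γ)(t − 1/2)²; in that case necessarily t₀ = 1/2. -/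
open Polynomial

theorem deriv_mul_pow_mul_sub_one_pow {n : ℕ} (hn : 1 ≤ n) (α t : ℂ) :
    deriv (fun t : ℂ => α * t ^ n * (t - 1) ^ n) t =
      α * n * (t * (t - 1)) ^ (n - 1) * (2 * t - 1) := by
  obtain ⟨m, rfl⟩ := Nat.exists_eq_add_of_le' hn
  have h := (((hasDerivAt_id t).pow (m + 1)).const_mul α).mul
    (((hasDerivAt_id t).sub_const 1).pow (m + 1))
  refine (h.congr_deriv ?_).deriv
  simp only [id, Pi.pow_apply, Nat.add_sub_cancel, mul_pow]
  push_cast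
  ring

theorem deriv_mul_pow_mul_sub_one_pow_eq_zero_iff {n : ℕ} (hn : 1 ≤ n) {α t : ℂ} (hα : α ≠ 0)
    (h0 : t ≠ 0) (h1 : t ≠ 1) :
    deriv (fun t : ℂ => α * t ^ n * (t - 1) ^ n) t = 0 ↔ t = 1 / 2 := by
  have hn' : (n : ℂ) ≠ 0 := Nat.cast_ne_zero.mpr (by omega)
  have hc : α * n * (t * (t - 1)) ^ (n - 1) ≠ 0 :=
    mul_ne_zero (mul_ne_zero hα hn') (pow_ne_zero _ (mul_ne_zero h0 (sub_ne_zero.mpr h1)))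
  rw [deriv_mul_pow_mul_sub_one_pow hn, mul_eq_zero, or_iff_right hc]
  constructor <;> intro h
  · linear_combination h / 2
  · linear_combination 2 * h

theorem deriv_mul_eval_div_of_isRoot (β : ℂ) {S : ℂ[X]} {t : ℂ} (hS : S.eval t = 0)
    (h0 : t ≠ 0) (h1 : t ≠ 1) :
    deriv (fun t : ℂ => β * S.eval t / (t * (t - 1))) t =
      β * S.derivative.eval t / (t * (t - 1)) := by
  have hd : t * (t - 1) ≠ 0 := mul_ne_zero h0 (sub_ne_zero.mpr h1)
  have h := ((S.hasDerivAt t).const_mul β).div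
    ((hasDerivAt_id t).mul ((hasDerivAt_id t).sub_const 1)) hd
  refine (h.congr_deriv ?_).deriv
  simp only [id, Pi.mul_apply, hS]
  field_simp
  ring

/-- A monic cubic has a double root at `a` iff it is `(X - γ) * (X - a) ^ 2` for some `γ`. -/
theorem Polynomial.Monic.isRoot_and_isRoot_derivative_iff_of_natDegree_eq_three
    {R : Type*} [CommRing R] [IsDomain R] {S : R[X]} (hS : S.Monic) (hdeg : S.natDegree = 3)
    (a : R) :
    S.IsRoot a ∧ S.derivative.IsRoot a ↔ ∃ γ : R, S = (X - C γ) * (X - C a) ^ 2 := by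
  constructor
  · intro h
    have hm := (one_lt_rootMultiplicity_iff_isRoot hS.ne_zero).mpr h
    obtain ⟨q, rfl⟩ := (le_rootMultiplicity_iff hS.ne_zero).mp hm
    have hX : ((X - C a) ^ (1 + 1)).Monic := (monic_X_sub_C a).pow _
    have hq : q.Monic := hX.of_mul_monic_left hS
    have hqdeg : q.natDegree = 1 := by
      rw [hX.natDegree_mul hq, (monic_X_sub_C a).natDegree_pow, natDegree_X_sub_C] at hdeg
      omega
    refine ⟨-q.coeff 0, ?_⟩
    rw [C_neg, sub_neg_eq_add, ← hq.eq_X_add_C hqdeg, mul_comm]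
  · rintro ⟨γ, rfl⟩
    simp [derivative_mul, derivative_pow]

/-- For `x(t) = α t^n (t-1)^n` and `y(t) = β S(t)/(t(t-1))` with `S`
monic cubic and `α, β ≠ 0`: there exists `t₀ ∈ ℂ \ {0,1}` with
`x'(t₀) = 0`, `y(t₀) = 0`, `y'(t₀) = 0` iff `S(t) = (t - γ)(t - 1/2)²` for some `γ`;
and any such `t₀` necessarily equals `1/2`. -/
theorem stmt_12 (n : ℕ) (hn : 1 ≤ n) (α β : ℂ) (hα : α ≠ 0) (hβ : β ≠ 0)
    (S : ℂ[X]) (hSm : S.Monic) (hSdeg : S.natDegree = 3) :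
    ((∃ t₀ : ℂ, t₀ ≠ 0 ∧ t₀ ≠ 1 ∧
        deriv (fun t : ℂ => α * t ^ n * (t - 1) ^ n) t₀ = 0 ∧
        β * S.eval t₀ / (t₀ * (t₀ - 1)) = 0 ∧
        deriv (fun t : ℂ => β * S.eval t / (t * (t - 1))) t₀ = 0) ↔
      (∃ γ : ℂ, S = (X - C γ) * (X - C (1 / 2)) ^ 2)) ∧
    (∀ t₀ : ℂ, t₀ ≠ 0 → t₀ ≠ 1 →
        deriv (fun t : ℂ => α * t ^ n * (t - 1) ^ n) t₀ = 0 →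
        β * S.eval t₀ / (t₀ * (t₀ - 1)) = 0 →
        deriv (fun t : ℂ => β * S.eval t / (t * (t - 1))) t₀ = 0 →
        t₀ = 1 / 2) := by
  have key : ∀ t : ℂ, t ≠ 0 → t ≠ 1 →
      ((β * S.eval t / (t * (t - 1)) = 0 ∧
        deriv (fun t : ℂ => β * S.eval t / (t * (t - 1))) t = 0) ↔
      (S.IsRoot t ∧ S.derivative.IsRoot t)) := by
    intro t h0 h1
    have h1' : t - 1 ≠ 0 := sub_ne_zero.mpr h1
    have hy : ∀ z : ℂ, β * z / (t * (t - 1)) = 0 ↔ z = 0 := fun z => by simp [hβ, h0, h1']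
    rw [hy]
    refine and_congr_right fun hS => ?_
    rw [deriv_mul_eval_div_of_isRoot β hS h0 h1, hy, IsRoot.def]
  have hcrit := fun t : ℂ => deriv_mul_pow_mul_sub_one_pow_eq_zero_iff (t := t) hn hα
  refine ⟨?_, fun t h0 h1 hx _ _ => (hcrit t h0 h1).mp hx⟩
  rw [← hSm.isRoot_and_isRoot_derivative_iff_of_natDegree_eq_three hSdeg]
  constructor
  · rintro ⟨t, h0, h1, hx, hy⟩
    obtain rfl := (hcrit t h0 h1).mp hx
    exact (key _ h0 h1).mp hy
  · intro h
    have h0 : (1 / 2 : ℂ) ≠ 0 := by norm_num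
    have h1 : (1 / 2 : ℂ) ≠ 1 := by norm_num
    exact ⟨1 / 2, h0, h1, (hcrit _ h0 h1).mpr rfl, (key _ h0 h1).mpr h⟩
end

section
/- Let n ≥ 1 be an integer, let α, β be nonzero complex numbers, and let γ ∈ ℂ. Define x(t) = α·t^n·(t − 1)^n and y(t) = β·(t − γ)(t − 1/2)²/(t(t − 1)) on ℂ \ {0, 1}. Then x′(1/2) = 0 and y′(1/2) = 0, and the two vectors (x″(1/2), y″(1/2)) and (x‴(1/2), y‴(1/2)) in ℂ² are linearly independent over ℂ. -/
open Filter Topology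

theorem AnalyticAt.deriv_mul_sub_sq {h : ℂ → ℂ} {a : ℂ} (hh : AnalyticAt ℂ h a) :
    deriv (fun t => h t * (t - a) ^ 2) =ᶠ[𝓝 a]
      fun t => deriv h t * (t - a) ^ 2 + 2 * (h t * (t - a)) := by
  filter_upwards [hh.eventually_analyticAt] with t ht
  have h1 := ht.differentiableAt.hasDerivAt
  have h2 := ((hasDerivAt_id t).sub_const a).pow 2
  refine ((h1.mul h2).congr_deriv ?_).deriv
  simp only [id, Pi.pow_apply]
  push_cast
  ring

theorem AnalyticAt.deriv_mul_sub {h : ℂ → ℂ} {a : ℂ} (hh : AnalyticAt ℂ h a) :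
    deriv (fun t => h t * (t - a)) =ᶠ[𝓝 a] fun t => deriv h t * (t - a) + h t := by
  filter_upwards [hh.eventually_analyticAt] with t ht
  have h1 := ht.differentiableAt.hasDerivAt
  have h2 := (hasDerivAt_id t).sub_const a
  refine ((h1.mul h2).congr_deriv ?_).deriv
  simp only [id]
  ring

theorem AnalyticAt.deriv_deriv_deriv_mul_sub_sq {h : ℂ → ℂ} {a : ℂ} (hh : AnalyticAt ℂ h a) :
    deriv (deriv (deriv (fun t => h t * (t - a) ^ 2))) a = 6 * deriv h a := by
  have second : deriv (deriv (fun t => h t * (t - a) ^ 2)) =ᶠ[𝓝 a]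
      fun t => deriv (deriv h) t * (t - a) ^ 2 + 4 * (deriv h t * (t - a)) + 2 * h t := by
    filter_upwards [hh.deriv_mul_sub_sq.deriv, hh.deriv.deriv_mul_sub_sq, hh.deriv_mul_sub,
      hh.eventually_analyticAt] with t e1 e2 e3 ht
    have d1 : DifferentiableAt ℂ (fun t => deriv h t * (t - a) ^ 2) t :=
      ht.deriv.differentiableAt.mul (by fun_prop)
    have d2 : DifferentiableAt ℂ (fun t => h t * (t - a)) t :=
      ht.differentiableAt.mul (by fun_prop)
    rw [e1, deriv_fun_add d1 (d2.const_mul 2), deriv_const_mul _ d2, e2, e3]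
    ring
  have d1 : DifferentiableAt ℂ (fun t => deriv (deriv h) t * (t - a) ^ 2) a :=
    hh.deriv.deriv.differentiableAt.mul (by fun_prop)
  have d2 : DifferentiableAt ℂ (fun t => deriv h t * (t - a)) a :=
    hh.deriv.differentiableAt.mul (by fun_prop)
  rw [second.deriv_eq,
    deriv_fun_add (d1.fun_add (d2.const_mul 4)) (hh.differentiableAt.const_mul 2),
    deriv_fun_add d1 (d2.const_mul 4), deriv_const_mul _ d2,
    deriv_const_mul _ hh.differentiableAt, hh.deriv.deriv.deriv_mul_sub_sq.eq_of_nhds,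
    hh.deriv.deriv_mul_sub.eq_of_nhds]
  ring

theorem deriv_deriv_deriv_eq_zero_of_symmetric {f : ℂ → ℂ} (hf : ∀ t, f (1 - t) = f t) :
    deriv (deriv (deriv f)) (1 / 2) = 0 := by
  have e1 : ∀ t, deriv f (1 - t) = -deriv f t := fun t => by
    have := deriv_comp_const_sub (f := f) 1 t
    rw [funext hf] at this
    rw [this, neg_neg]
  have e2 : ∀ t, deriv (deriv f) (1 - t) = deriv (deriv f) t := fun t => by
    have := deriv_comp_const_sub (f := deriv f) 1 t
    rw [funext e1, deriv.fun_neg] at this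
    exact (neg_injective this).symm
  have e3 := deriv_comp_const_sub (f := deriv (deriv f)) 1 (1 / 2)
  rw [funext e2] at e3
  norm_num at e3 ⊢
  exact self_eq_neg.mp e3

theorem hasDerivAt_const_mul_pow_mul_pow (k : ℕ) (α t : ℂ) :
    HasDerivAt (fun t : ℂ => α * t ^ (k + 1) * (t - 1) ^ (k + 1))
      (2 * α * (k + 1) * (t * (t - 1)) ^ k * (t - 1 / 2)) t := by
  have h1 := ((hasDerivAt_id t).pow (k + 1)).const_mul α
  have h2 := ((hasDerivAt_id t).sub_const 1).pow (k + 1)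
  refine (h1.mul h2).congr_deriv ?_
  simp only [id, Pi.pow_apply, Nat.add_sub_cancel, mul_pow]
  push_cast
  ring

theorem linearIndependent_pair_prod_of_ne_zero {a b d : ℂ} (ha : a ≠ 0) (hd : d ≠ 0) :
    LinearIndependent ℂ ![(a, b), (0, d)] := by
  rw [LinearIndependent.pair_iff]
  intro s t h
  simp only [Prod.smul_mk, Prod.mk_add_mk, Prod.mk_eq_zero, smul_eq_mul, mul_zero, add_zero] at h
  obtain ⟨h1, h2⟩ := h
  have hs : s = 0 := (mul_eq_zero.mp h1).resolve_right ha
  subst hs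
  simpa [hd] using h2

/-- For `x(t) = α t^n (t-1)^n` and
`y(t) = β (t-γ)(t-1/2)²/(t(t-1))` with `α, β ≠ 0`, one has `x'(1/2) = y'(1/2) = 0`,
and the vectors `(x''(1/2), y''(1/2))` and `(x'''(1/2), y'''(1/2))` in `ℂ²` are
linearly independent over `ℂ`. -/
theorem stmt_13 (n : ℕ) (hn : 1 ≤ n) (α β γ : ℂ) (hα : α ≠ 0) (hβ : β ≠ 0) :
    deriv (fun t : ℂ => α * t ^ n * (t - 1) ^ n) (1 / 2) = 0 ∧
    deriv (fun t : ℂ => β * (t - γ) * (t - 1 / 2) ^ 2 / (t * (t - 1))) (1 / 2) = 0 ∧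
    LinearIndependent ℂ
      ![(deriv (deriv (fun t : ℂ => α * t ^ n * (t - 1) ^ n)) (1 / 2 : ℂ),
         deriv (deriv (fun t : ℂ => β * (t - γ) * (t - 1 / 2) ^ 2 / (t * (t - 1))))
           (1 / 2 : ℂ)),
        (deriv (deriv (deriv (fun t : ℂ => α * t ^ n * (t - 1) ^ n))) (1 / 2 : ℂ),
         deriv (deriv (deriv (fun t : ℂ => β * (t - γ) * (t - 1 / 2) ^ 2 / (t * (t - 1)))))
           (1 / 2 : ℂ))] := by
  obtain ⟨k, rfl⟩ : ∃ k, n = k + 1 := ⟨n - 1, by omega⟩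
  have hx : deriv (fun t : ℂ => α * t ^ (k + 1) * (t - 1) ^ (k + 1)) =
      fun t => 2 * α * (k + 1) * (t * (t - 1)) ^ k * (t - 1 / 2) :=
    funext fun t => (hasDerivAt_const_mul_pow_mul_pow k α t).deriv
  have hx3 : deriv (deriv (deriv (fun t : ℂ => α * t ^ (k + 1) * (t - 1) ^ (k + 1)))) (1 / 2) =
      0 :=
    deriv_deriv_deriv_eq_zero_of_symmetric fun t => by
      rw [mul_assoc, mul_assoc, ← mul_pow, ← mul_pow]
      ring
  have hx2 : deriv (deriv (fun t : ℂ => α * t ^ (k + 1) * (t - 1) ^ (k + 1))) (1 / 2) ≠ 0 := by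
    have hg : AnalyticAt ℂ (fun t : ℂ => 2 * α * (k + 1) * (t * (t - 1)) ^ k) (1 / 2) := by
      fun_prop
    rw [hx, hg.deriv_mul_sub.eq_of_nhds, sub_self, mul_zero, zero_add]
    have hk : (k : ℂ) + 1 ≠ 0 := Nat.cast_add_one_ne_zero k
    have hq : (1 / 2 : ℂ) * (1 / 2 - 1) ≠ 0 := by norm_num
    exact mul_ne_zero (mul_ne_zero (mul_ne_zero two_ne_zero hα) hk) (pow_ne_zero k hq)
  have hy : (fun t : ℂ => β * (t - γ) * (t - 1 / 2) ^ 2 / (t * (t - 1))) =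
      fun t => β * (t - γ) / (t * (t - 1)) * (t - 1 / 2) ^ 2 :=
    funext fun t => by ring
  have hh : AnalyticAt ℂ (fun t : ℂ => β * (t - γ) / (t * (t - 1))) (1 / 2) :=
    AnalyticAt.div (by fun_prop) (by fun_prop) (by norm_num)
  have hh' : deriv (fun t : ℂ => β * (t - γ) / (t * (t - 1))) (1 / 2) = -4 * β := by
    have h1 := ((hasDerivAt_id (1 / 2 : ℂ)).sub_const γ).const_mul β
    have h2 := (hasDerivAt_id (1 / 2 : ℂ)).mul ((hasDerivAt_id (1 / 2 : ℂ)).sub_const 1)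
    refine ((h1.div h2 (by norm_num)).congr_deriv ?_).deriv
    simp only [id, Pi.mul_apply]
    norm_num
    ring
  refine ⟨by simp [hx], ?_, ?_⟩
  · rw [hy, hh.deriv_mul_sub_sq.eq_of_nhds]
    simp
  · rw [hx3, hy, hh.deriv_deriv_deriv_mul_sub_sq, hh']
    exact linearIndependent_pair_prod_of_ne_zero hx2
      (mul_ne_zero (by norm_num) (mul_ne_zero (by norm_num) hβ))
end

section
/- Let p, m, r be positive integers, set d₁ = gcd(p, r) and d₂ = gcd(p + m, r), and let α, β be nonzero complex numbers. Then the set of pairs (a, b) of nonzero complex numbers satisfying a^{p/d₁} = α·b^{r/d₁} and a^{(p+m)/d₂} = β·b^{r/d₂} is finite of cardinality exactly m·r/(d₁·d₂). -/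
section CoprimePowers

variable {G₀ : Type*} [CommGroupWithZero G₀] {P R : ℕ}

theorem zpow_bezout_eq_self (h : Nat.Coprime R P) {t : G₀} (ht : t ≠ 0) :
    (t ^ R) ^ Nat.gcdA R P * (t ^ P) ^ Nat.gcdB R P = t := by
  have hb := Nat.gcd_eq_gcd_ab R P
  rw [h.gcd_eq_one] at hb
  rw [← zpow_natCast, ← zpow_natCast, ← zpow_mul, ← zpow_mul, ← zpow_add₀ ht, ← hb]
  simp

theorem eq_of_pow_eq_pow_of_coprime (h : Nat.Coprime R P) {s t : G₀} (hs : s ≠ 0) (ht : t ≠ 0)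
    (hR : s ^ R = t ^ R) (hP : s ^ P = t ^ P) : s = t := by
  rw [← zpow_bezout_eq_self h hs, hR, hP, zpow_bezout_eq_self h ht]

theorem exists_pow_eq_and_pow_eq_of_coprime (h : Nat.Coprime R P) {u v : G₀} (hu : u ≠ 0)
    (hv : v ≠ 0) (huv : u ^ P = v ^ R) : ∃ t : G₀, t ≠ 0 ∧ t ^ R = u ∧ t ^ P = v := by
  refine ⟨u ^ Nat.gcdA R P * v ^ Nat.gcdB R P,
    mul_ne_zero (zpow_ne_zero _ hu) (zpow_ne_zero _ hv), ?_, ?_⟩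
  · conv_rhs => rw [← zpow_bezout_eq_self h hu, huv]
    simp only [← zpow_natCast, ← zpow_mul, mul_zpow, mul_comm]
  · conv_rhs => rw [← zpow_bezout_eq_self h hv, ← huv]
    simp only [← zpow_natCast, ← zpow_mul, mul_zpow, mul_comm]

end CoprimePowers

theorem Complex.setOf_pow_eq_finite_and_ncard {N : ℕ} (hN : 0 < N) {γ : ℂ} (hγ : γ ≠ 0) :
    {t : ℂ | t ^ N = γ}.Finite ∧ {t : ℂ | t ^ N = γ}.ncard = N := by
  classical
  have hζ := Complex.isPrimitiveRoot_exp N hN.ne'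
  have hset : {t : ℂ | t ^ N = γ} = ((Polynomial.nthRoots N γ).toFinset : Set ℂ) := by
    ext t
    simp [Polynomial.mem_nthRoots hN]
  rw [hset]
  refine ⟨Finset.finite_toSet _, ?_⟩
  rw [Set.ncard_coe_finset, Multiset.toFinset_card_of_nodup (hζ.nthRoots_nodup hγ),
    hζ.card_nthRoots, if_pos (IsAlgClosed.exists_pow_nat_eq γ hN)]

theorem Complex.binomial_system_finite_and_ncard {P R Q S N : ℕ} (hP : 0 < P) (hN : 0 < N)
    (hPR : Nat.Coprime R P) (hdet : R * Q = P * S + N) {α β : ℂ} (hα : α ≠ 0) (hβ : β ≠ 0) :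
    {ab : ℂ × ℂ | ab.1 ≠ 0 ∧ ab.2 ≠ 0 ∧ ab.1 ^ P = α * ab.2 ^ R ∧
      ab.1 ^ Q = β * ab.2 ^ S}.Finite ∧
    {ab : ℂ × ℂ | ab.1 ≠ 0 ∧ ab.2 ≠ 0 ∧ ab.1 ^ P = α * ab.2 ^ R ∧
      ab.1 ^ Q = β * ab.2 ^ S}.ncard = N := by
  obtain ⟨c, rfl⟩ := IsAlgClosed.exists_pow_nat_eq α hP
  have hc : c ≠ 0 := by
    rintro rfl
    simp [hP.ne'] at hα
  have hcQ : c ^ Q ≠ 0 := pow_ne_zero _ hc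
  have hγ : β / c ^ Q ≠ 0 := div_ne_zero hβ hcQ
  have hne {t : ℂ} (ht : t ^ N = β / c ^ Q) : t ≠ 0 := by
    rintro rfl
    rw [zero_pow hN.ne'] at ht
    exact hγ ht.symm
  have hiff {t : ℂ} (ht : t ≠ 0) :
      (c * t ^ R) ^ Q = β * (t ^ P) ^ S ↔ t ^ N = β / c ^ Q := by
    rw [mul_pow, ← pow_mul, ← pow_mul, hdet, pow_add, eq_div_iff hcQ]
    refine ⟨fun h => mul_left_cancel₀ (pow_ne_zero (P * S) ht) ?_, fun h => ?_⟩
    · linear_combination h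
    · linear_combination t ^ (P * S) * h
  have himage : {ab : ℂ × ℂ | ab.1 ≠ 0 ∧ ab.2 ≠ 0 ∧ ab.1 ^ P = c ^ P * ab.2 ^ R ∧
      ab.1 ^ Q = β * ab.2 ^ S} =
      (fun t : ℂ => (c * t ^ R, t ^ P)) '' {t : ℂ | t ^ N = β / c ^ Q} := by
    ext ⟨a, b⟩
    simp only [Set.mem_ofPred_eq, Set.mem_image, Prod.mk.injEq]
    constructor
    · rintro ⟨ha, hb, h₁, h₂⟩
      have huv : (a / c) ^ P = b ^ R := by
        rw [div_pow, h₁, mul_div_cancel_left₀ _ (pow_ne_zero _ hc)]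
      obtain ⟨t, ht, htR, rfl⟩ :=
        exists_pow_eq_and_pow_eq_of_coprime hPR (div_ne_zero ha hc) hb huv
      obtain rfl : c * t ^ R = a := by rw [htR, mul_div_cancel₀ _ hc]
      exact ⟨t, (hiff ht).1 h₂, rfl, rfl⟩
    · rintro ⟨t, h, rfl, rfl⟩
      have ht := hne h
      exact ⟨mul_ne_zero hc (pow_ne_zero _ ht), pow_ne_zero _ ht, by ring, (hiff ht).2 h⟩
  have hinj : Set.InjOn (fun t : ℂ => (c * t ^ R, t ^ P)) {t : ℂ | t ^ N = β / c ^ Q} := by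
    intro s hs t ht hst
    obtain ⟨h₁, h₂⟩ := Prod.mk.inj hst
    exact eq_of_pow_eq_pow_of_coprime hPR (hne hs) (hne ht) (mul_left_cancel₀ hc h₁) h₂
  obtain ⟨hfin, hcard⟩ := Complex.setOf_pow_eq_finite_and_ncard hN hγ
  rw [himage]
  exact ⟨hfin.image _, by rw [hinj.ncard_image, hcard]⟩

/-- For positive integers `p, m, r`, `d₁ = gcd(p, r)`,
`d₂ = gcd(p+m, r)`, and nonzero `α, β ∈ ℂ`, the set of pairs `(a, b)` of nonzero
complex numbers with `a^{p/d₁} = α b^{r/d₁}` and `a^{(p+m)/d₂} = β b^{r/d₂}` is finite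
of cardinality exactly `m·r/(d₁·d₂)`. -/
theorem stmt_14 (p m r : ℕ) (hp : 0 < p) (hm : 0 < m) (hr : 0 < r)
    (d₁ d₂ : ℕ) (hd₁ : d₁ = Nat.gcd p r) (hd₂ : d₂ = Nat.gcd (p + m) r)
    (α β : ℂ) (hα : α ≠ 0) (hβ : β ≠ 0) :
    {ab : ℂ × ℂ | ab.1 ≠ 0 ∧ ab.2 ≠ 0 ∧
        ab.1 ^ (p / d₁) = α * ab.2 ^ (r / d₁) ∧
        ab.1 ^ ((p + m) / d₂) = β * ab.2 ^ (r / d₂)}.Finite ∧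
    {ab : ℂ × ℂ | ab.1 ≠ 0 ∧ ab.2 ≠ 0 ∧
        ab.1 ^ (p / d₁) = α * ab.2 ^ (r / d₁) ∧
        ab.1 ^ ((p + m) / d₂) = β * ab.2 ^ (r / d₂)}.ncard = m * r / (d₁ * d₂) := by
  have hd₁0 : 0 < d₁ := hd₁ ▸ Nat.gcd_pos_of_pos_left _ hp
  have hd₂0 : 0 < d₂ := hd₂ ▸ Nat.gcd_pos_of_pos_right _ hr
  have hcop : Nat.Coprime (r / d₁) (p / d₁) := by
    subst hd₁
    exact (Nat.coprime_div_gcd_div_gcd hd₁0).symm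
  obtain ⟨P, hP⟩ : d₁ ∣ p := hd₁ ▸ Nat.gcd_dvd_left _ _
  obtain ⟨R, hR⟩ : d₁ ∣ r := hd₁ ▸ Nat.gcd_dvd_right _ _
  obtain ⟨Q, hQ⟩ : d₂ ∣ p + m := hd₂ ▸ Nat.gcd_dvd_left _ _
  obtain ⟨S, hS⟩ : d₂ ∣ r := hd₂ ▸ Nat.gcd_dvd_right _ _
  have hPdiv : p / d₁ = P := by rw [hP, Nat.mul_div_cancel_left _ hd₁0]
  have hRdiv : r / d₁ = R := by rw [hR, Nat.mul_div_cancel_left _ hd₁0]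
  have hQdiv : (p + m) / d₂ = Q := by rw [hQ, Nat.mul_div_cancel_left _ hd₂0]
  have hSdiv : r / d₂ = S := by rw [hS, Nat.mul_div_cancel_left _ hd₂0]
  have hmul : d₁ * d₂ * (R * Q) = d₁ * d₂ * (P * S) + m * r := by
    calc d₁ * d₂ * (R * Q) = (d₁ * R) * (d₂ * Q) := by ring
      _ = p * r + m * r := by rw [← hR, ← hQ]; ring
      _ = (d₁ * P) * (d₂ * S) + m * r := by rw [← hP, ← hS]
      _ = d₁ * d₂ * (P * S) + m * r := by ring
  have hdd : 0 < d₁ * d₂ := Nat.mul_pos hd₁0 hd₂0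
  obtain ⟨N, hN⟩ : d₁ * d₂ ∣ m * r :=
    (Nat.dvd_add_right (Dvd.intro _ rfl)).1 (hmul ▸ Dvd.intro _ rfl)
  have hN0 : 0 < N := Nat.pos_of_mul_pos_left (hN ▸ Nat.mul_pos hm hr)
  have hdet : R * Q = P * S + N := by
    rw [hN, ← mul_add] at hmul
    exact Nat.eq_of_mul_eq_mul_left hdd hmul
  have hP0 : 0 < P := Nat.pos_of_mul_pos_left (hP ▸ hp)
  rw [hRdiv, hPdiv] at hcop
  rw [hPdiv, hRdiv, hQdiv, hSdiv, hN, Nat.mul_div_cancel_left _ hdd]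
  exact Complex.binomial_system_finite_and_ncard hP0 hN0 hcop hdet hα hβ
end

section
/- The set of monic cubic polynomials f ∈ ℂ[X] whose coefficient of X² vanishes and such that f² − 1 has a root of multiplicity at least 3 equals {X³ + 1, X³ − 1}; in particular this set has exactly 2 = θ(3) elements. -/
open Polynomial

/-- A monic cubic without quadratic term that is divisible by the cube of a linear polynomial
is `X ^ 3`. -/
theorem eq_X_pow_three_of_X_sub_C_pow_three_dvd {K : Type*} [Field K] [NeZero (3 : K)]
    {g : K[X]} (hg : g.Monic) (hdeg : g.natDegree = 3) (hcoeff : g.coeff 2 = 0) {x : K}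
    (hdvd : (X - C x) ^ 3 ∣ g) : g = X ^ 3 := by
  have h : g = (X - C x) ^ 3 :=
    eq_of_monic_of_dvd_of_natDegree_le ((monic_X_sub_C x).pow 3) hg hdvd
      (by rw [hdeg, natDegree_pow, natDegree_X_sub_C])
  have hexp : (X - C x) ^ 3 = X ^ 3 - C (3 * x) * X ^ 2 + C (3 * x ^ 2) * X - C (x ^ 3) := by
    simp only [map_mul, map_pow, map_ofNat]
    ring
  have hx : x = 0 := by
    rw [h, hexp] at hcoeff
    simp only [coeff_add, coeff_sub, coeff_C_mul, coeff_X_pow, coeff_X, coeff_C] at hcoeff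
    simpa [NeZero.ne (3 : K)] using hcoeff
  simpa [hx] using h

/-- If `a` and `b` differ by a nonzero constant, then a power of a linear polynomial
dividing `a * b` divides `a` or `b`. -/
theorem X_sub_C_pow_dvd_or_dvd_of_dvd_mul {K : Type*} [Field K] {a b : K[X]} {c x : K}
    (hc : c ≠ 0) (hab : b - a = C c) {n : ℕ} (hdvd : (X - C x) ^ n ∣ a * b) :
    (X - C x) ^ n ∣ a ∨ (X - C x) ^ n ∣ b := by
  by_cases ha : X - C x ∣ a
  · refine .inl ((prime_X_sub_C x).pow_dvd_of_dvd_mul_right n (fun hb => ?_) hdvd)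
    have h := dvd_sub hb ha
    rw [hab, dvd_iff_isRoot] at h
    simp [hc] at h
  · exact .inr ((prime_X_sub_C x).pow_dvd_of_dvd_mul_left n ha hdvd)

theorem three_le_rootMultiplicity_zero_of_eq_X_pow_three_mul {K : Type*} [Field K] {p q : K[X]}
    (hp : p = X ^ 3 * q) (hq : q.Monic) : 3 ≤ rootMultiplicity 0 p := by
  have hp0 : p ≠ 0 := hp ▸ ((monic_X_pow 3).mul hq).ne_zero
  rw [le_rootMultiplicity_iff hp0, hp]
  simp

/-- The characterization of the monic cubics `f` without quadratic term
such that `f ^ 2 - 1` has a root of multiplicity at least three. -/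
theorem setOf_monic_cubic_three_le_rootMultiplicity :
    {f : ℂ[X] | f.Monic ∧ f.natDegree = 3 ∧ f.coeff 2 = 0 ∧
        ∃ x : ℂ, 3 ≤ rootMultiplicity x (f ^ 2 - 1)}
      = {X ^ 3 + 1, X ^ 3 - 1} := by
  have hshift (c : ℂ) : (X ^ 3 + C c : ℂ[X]).Monic ∧ (X ^ 3 + C c : ℂ[X]).natDegree = 3 ∧
      (X ^ 3 + C c : ℂ[X]).coeff 2 = 0 :=
    ⟨monic_X_pow_add_C c three_ne_zero, natDegree_X_pow_add_C, by simp [coeff_X_pow]⟩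
  ext f
  simp only [Set.mem_ofPred_eq, Set.mem_insert_iff, Set.mem_singleton_iff]
  constructor
  · rintro ⟨hf, hdeg, hcoeff, x, hx⟩
    have key (c : ℂ) (h : (X - C x) ^ 3 ∣ f - C c) : f = X ^ 3 + C c := by
      refine sub_eq_iff_eq_add.mp (eq_X_pow_three_of_X_sub_C_pow_three_dvd ?_ ?_ ?_ h)
      · exact hf.sub_of_left (degree_C_le.trans_lt (natDegree_pos_iff_degree_pos.mp (by lia)))
      · rw [natDegree_sub_C, hdeg]
      · simp [hcoeff]
    have hdvd : (X - C x) ^ 3 ∣ (f - C 1) * (f - C (-1)) := by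
      refine ((pow_dvd_pow _ hx).trans (pow_rootMultiplicity_dvd _ x)).trans (dvd_of_eq ?_)
      simp only [map_neg, map_one]
      ring
    have hsub : f - C (-1) - (f - C 1) = C 2 := by
      rw [sub_sub_sub_cancel_left, ← C_sub]
      norm_num
    rcases X_sub_C_pow_dvd_or_dvd_of_dvd_mul two_ne_zero hsub hdvd with h | h
    · exact .inl (by simpa using key 1 h)
    · exact .inr (by simpa [sub_eq_add_neg] using key (-1) h)
  · rintro (rfl | rfl)
    · obtain ⟨h₁, h₂, h₃⟩ := hshift 1
      rw [map_one] at h₁ h₂ h₃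
      refine ⟨h₁, h₂, h₃, 0, three_le_rootMultiplicity_zero_of_eq_X_pow_three_mul ?_
        (hshift 2).1⟩
      rw [map_ofNat]
      ring
    · obtain ⟨h₁, h₂, h₃⟩ := hshift (-1)
      rw [map_neg, map_one, ← sub_eq_add_neg] at h₁ h₂ h₃
      refine ⟨h₁, h₂, h₃, 0, three_le_rootMultiplicity_zero_of_eq_X_pow_three_mul ?_
        (hshift (-2)).1⟩
      rw [map_neg, map_ofNat]
      ring

/-- The set of monic cubic polynomials `f ∈ ℂ[X]` with vanishing
coefficient of `X²` such that `f² - 1` has a root of multiplicity at least 3 equals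
`{X³ + 1, X³ - 1}`; in particular it has exactly `2 = θ(3)` elements. -/
theorem stmt_16 :
    {f : ℂ[X] | f.Monic ∧ f.natDegree = 3 ∧ f.coeff 2 = 0 ∧
        ∃ x : ℂ, 3 ≤ rootMultiplicity x (f ^ 2 - 1)}
      = {X ^ 3 + 1, X ^ 3 - 1} ∧
    {f : ℂ[X] | f.Monic ∧ f.natDegree = 3 ∧ f.coeff 2 = 0 ∧
        ∃ x : ℂ, 3 ≤ rootMultiplicity x (f ^ 2 - 1)}.ncard = 2 := by
  refine ⟨setOf_monic_cubic_three_le_rootMultiplicity, ?_⟩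
  rw [setOf_monic_cubic_three_le_rootMultiplicity]
  refine Set.ncard_pair fun h => ?_
  have h₀ := congrArg (eval 0) h
  norm_num at h₀
end
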